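/- arXiv:2106.06404 — 4 statements merged into one kernel-verified Lean document; each statement's English description precedes it below -/
import Mathlib

section
/- Let V be a finite-dimensional real inner product space with inner product a and norm ‖·‖_a, and let a_0, b_0, C_1 > 0. Let q_1, …, q_P be symmetric positive semidefinite bilinear forms on V satisfying Σ_{i=1}^P q_i(w, w) ≤ b_0 ‖w‖_a² for all w ∈ V. Suppose v_l ∈ V and v_{l,1}, …, v_{l,P} ∈ V satisfy ‖v_{l,i}‖_a² ≤ C_1 q_i(v_l, v_l) for each i, and ‖Σ_{i=1}^P v_{l,i}‖_a² ≤ a_0 Σ_{i=1}^P ‖v_{l,i}‖_a². Then v_{l−1} := v_l − Σ_{i=1}^P v_{l,i} satisfies ‖v_{l−1}‖_a² + Σ_{i=1}^P ‖v_{l,i}‖_a² ≤ (2 + b_0 C_1 (1 + 2 a_0)) ‖v_l‖_a². -/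
/-- level-wise stability, second inequality (Lemma 2.5, second bound):
under the positive semi-definite splitting property, local stability and the
strengthened triangle inequality under the square, the decomposition
`v_l = v_{l−1} + ∑_i v_{l,i}` with `v_{l−1} = v_l − ∑_i v_{l,i}` satisfies
`‖v_{l−1}‖² + ∑_i ‖v_{l,i}‖² ≤ (2 + b₀ C₁ (1 + 2 a₀)) ‖v_l‖²`. -/
theorem levelwise_stability_full_bound
    {V : Type*} [NormedAddCommGroup V] [InnerProductSpace ℝ V] [FiniteDimensional ℝ V]
    (a0 b0 C1 : ℝ) (ha0 : 0 < a0) (hb0 : 0 < b0) (hC1 : 0 < C1)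
    (P : ℕ) (q : Fin P → LinearMap.BilinForm ℝ V)
    (hq_symm : ∀ i u v, q i u v = q i v u) (hq_psd : ∀ i v, 0 ≤ q i v v)
    (hsplit : ∀ w : V, ∑ i : Fin P, q i w w ≤ b0 * ‖w‖ ^ 2)
    (vl : V) (vli : Fin P → V)
    (hloc : ∀ i, ‖vli i‖ ^ 2 ≤ C1 * q i vl vl)
    (htri : ‖∑ i : Fin P, vli i‖ ^ 2 ≤ a0 * ∑ i : Fin P, ‖vli i‖ ^ 2) :
    ‖vl - ∑ i : Fin P, vli i‖ ^ 2 + ∑ i : Fin P, ‖vli i‖ ^ 2 ≤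
      (2 + b0 * C1 * (1 + 2 * a0)) * ‖vl‖ ^ 2 := by
  have hsum : ∑ i : Fin P, ‖vli i‖ ^ 2 ≤ C1 * (b0 * ‖vl‖ ^ 2) :=
    calc ∑ i : Fin P, ‖vli i‖ ^ 2 ≤ ∑ i : Fin P, C1 * q i vl vl :=
          Finset.sum_le_sum fun i _ => hloc i
      _ = C1 * ∑ i : Fin P, q i vl vl := (Finset.mul_sum _ _ _).symm
      _ ≤ C1 * (b0 * ‖vl‖ ^ 2) := mul_le_mul_of_nonneg_left (hsplit vl) hC1.le
  have hsub : ‖vl - ∑ i : Fin P, vli i‖ ^ 2 ≤ 2 * ‖vl‖ ^ 2 + 2 * ‖∑ i : Fin P, vli i‖ ^ 2 := by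
    have hpar := parallelogram_law_with_norm ℝ vl (∑ i : Fin P, vli i)
    nlinarith [sq_nonneg ‖vl + ∑ i : Fin P, vli i‖]
  have hmul := mul_le_mul_of_nonneg_left hsum ha0.le
  linarith
end

section
/- Let V be a finite-dimensional real inner product space with inner product a and norm ‖·‖_a, let a_0, b_0, C_1 > 0, set C = 2(1 + a_0 b_0 C_1), and let L ≥ 1. For each level l ∈ {1, …, L} let q_{l,1}, …, q_{l,P_l} be symmetric positive semidefinite bilinear forms on V satisfying Σ_{i=1}^{P_l} q_{l,i}(w, w) ≤ b_0 ‖w‖_a² for all w ∈ V. Given v ∈ V, suppose vectors v_L = v and, for l = L down to 1, vectors v_{l,i} ∈ V (1 ≤ i ≤ P_l) and v_{l−1} := v_l − Σ_{i=1}^{P_l} v_{l,i} satisfy ‖v_{l,i}‖_a² ≤ C_1 q_{l,i}(v_l, v_l) and ‖Σ_{i=1}^{P_l} v_{l,i}‖_a² ≤ a_0 Σ_{i=1}^{P_l} ‖v_{l,i}‖_a². Then ‖v_0‖_a² + Σ_{l=1}^L Σ_{i=1}^{P_l} ‖v_{l,i}‖_a² ≤ C^L (1 + b_0 C_1/(C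 − 1)) ‖v‖_a². -/
/-- If `e (l - 1) ≤ C * e l` and `s l ≤ m * (C - 1) * e l` on every level `l = 1, …, L`, then
`e 0 + ∑ l, s l` is bounded by the geometric factor `C ^ L * (1 + m) - m` times `e L`. -/
lemma add_sum_Icc_le_of_geometric {e s : ℕ → ℝ} {C m : ℝ} (hC : 1 ≤ C) (hm : 0 ≤ m) (L : ℕ)
    (he : ∀ l, 1 ≤ l → l ≤ L → e (l - 1) ≤ C * e l)
    (hs : ∀ l, 1 ≤ l → l ≤ L → s l ≤ m * (C - 1) * e l) :
    e 0 + ∑ l ∈ Finset.Icc 1 L, s l ≤ (C ^ L * (1 + m) - m) * e L := by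
  induction L with
  | zero => simp
  | succ n ih =>
    have hsum := ih (fun l h1 h2 => he l h1 (by omega)) (fun l h1 h2 => hs l h1 (by omega))
    have he' : e n ≤ C * e (n + 1) := he (n + 1) (by omega) le_rfl
    have hs' := hs (n + 1) (by omega) le_rfl
    have hpow : 1 ≤ C ^ n := one_le_pow₀ hC
    have hfac : 0 ≤ C ^ n * (1 + m) - m := by nlinarith
    rw [Finset.sum_Icc_succ_top (by omega)]
    calc e 0 + (∑ l ∈ Finset.Icc 1 n, s l + s (n + 1))
        ≤ (C ^ n * (1 + m) - m) * e n + m * (C - 1) * e (n + 1) := by linarith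
      _ ≤ (C ^ n * (1 + m) - m) * (C * e (n + 1)) + m * (C - 1) * e (n + 1) := by gcongr
      _ = (C ^ (n + 1) * (1 + m) - m) * e (n + 1) := by ring

lemma norm_sub_sq_le_two_mul {E : Type*} [SeminormedAddCommGroup E] (x y : E) :
    ‖x - y‖ ^ 2 ≤ 2 * (‖x‖ ^ 2 + ‖y‖ ^ 2) :=
  (pow_le_pow_left₀ (norm_nonneg _) (norm_sub_le x y) 2).trans add_sq_le


/-- multilevel stability (Lemma 2.7). Given, on each level `l = 1, …, L`,
bilinear forms `q_{l,i}` with the positive semi-definite splitting property, and a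
recursive decomposition `v_{l−1} = v_l − ∑_i v_{l,i}` starting from `v_L = v` which is
locally stable and satisfies the strengthened triangle inequality under the square, the
full multilevel decomposition satisfies
`‖v₀‖² + ∑_{l=1}^L ∑_i ‖v_{l,i}‖² ≤ C^L (1 + b₀C₁/(C−1)) ‖v‖²` with
`C = 2(1 + a₀ b₀ C₁)`. -/
theorem multilevel_stability
    {V : Type*} [NormedAddCommGroup V] [InnerProductSpace ℝ V] [FiniteDimensional ℝ V]
    (a0 b0 C1 : ℝ) (ha0 : 0 < a0) (hb0 : 0 < b0) (hC1 : 0 < C1)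
    (C : ℝ) (hC : C = 2 * (1 + a0 * b0 * C1))
    (L : ℕ) (hL : 1 ≤ L) (P : ℕ → ℕ)
    (q : (l : ℕ) → Fin (P l) → LinearMap.BilinForm ℝ V)
    (hq_symm : ∀ l, 1 ≤ l → l ≤ L → ∀ i u v, q l i u v = q l i v u)
    (hq_psd : ∀ l, 1 ≤ l → l ≤ L → ∀ i v, 0 ≤ q l i v v)
    (hsplit : ∀ l, 1 ≤ l → l ≤ L → ∀ w : V, ∑ i : Fin (P l), q l i w w ≤ b0 * ‖w‖ ^ 2)
    (v : V) (vseq : ℕ → V) (hvL : vseq L = v)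
    (w : (l : ℕ) → Fin (P l) → V)
    (hrec : ∀ l, 1 ≤ l → l ≤ L → vseq (l - 1) = vseq l - ∑ i : Fin (P l), w l i)
    (hloc : ∀ l, 1 ≤ l → l ≤ L → ∀ i, ‖w l i‖ ^ 2 ≤ C1 * q l i (vseq l) (vseq l))
    (htri : ∀ l, 1 ≤ l → l ≤ L →
      ‖∑ i : Fin (P l), w l i‖ ^ 2 ≤ a0 * ∑ i : Fin (P l), ‖w l i‖ ^ 2) :
    ‖vseq 0‖ ^ 2 + ∑ l ∈ Finset.Icc 1 L, ∑ i : Fin (P l), ‖w l i‖ ^ 2 ≤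
      C ^ L * (1 + b0 * C1 / (C - 1)) * ‖v‖ ^ 2 := by
  have hC1' : 0 < C - 1 := by
    have : 0 < a0 * b0 * C1 := by positivity
    linarith
  have hsum : ∀ l, 1 ≤ l → l ≤ L → ∑ i, ‖w l i‖ ^ 2 ≤ b0 * C1 * ‖vseq l‖ ^ 2 := by
    intro l h1 h2
    calc ∑ i, ‖w l i‖ ^ 2 ≤ ∑ i, C1 * q l i (vseq l) (vseq l) :=
          Finset.sum_le_sum fun i _ => hloc l h1 h2 i
      _ = C1 * ∑ i, q l i (vseq l) (vseq l) := by rw [Finset.mul_sum]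
      _ ≤ C1 * (b0 * ‖vseq l‖ ^ 2) := by gcongr; exact hsplit l h1 h2 _
      _ = b0 * C1 * ‖vseq l‖ ^ 2 := by ring
  have hstep : ∀ l, 1 ≤ l → l ≤ L → ‖vseq (l - 1)‖ ^ 2 ≤ C * ‖vseq l‖ ^ 2 := by
    intro l h1 h2
    rw [hrec l h1 h2, hC]
    have hmul := mul_le_mul_of_nonneg_left (hsum l h1 h2) ha0.le
    linarith [norm_sub_sq_le_two_mul (vseq l) (∑ i, w l i), htri l h1 h2]
  have hm : 0 ≤ b0 * C1 / (C - 1) := by positivity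
  have hmain := add_sum_Icc_le_of_geometric (e := fun l => ‖vseq l‖ ^ 2)
    (s := fun l => ∑ i, ‖w l i‖ ^ 2) (by linarith) hm L hstep
    (by simpa only [div_mul_cancel₀ _ hC1'.ne'] using hsum)
  rw [← hvL]
  refine hmain.trans ?_
  gcongr
  linarith
end

section
/- Let {a_τ}_{τ∈T} be a finite family of symmetric positive semidefinite bilinear forms on a real vector space V and set a = Σ_{τ∈T} a_τ. Let v_1, …, v_P ∈ V and let T_1, …, T_P ⊆ T be subsets such that every τ ∈ T belongs to at most k_0 of the sets T_i, and such that a_τ(v_i, w) = 0 for all w ∈ V whenever τ ∉ T_i. Then a(Σ_{i=1}^P v_i, Σ_{i=1}^P v_i) ≤ k_0 Σ_{i=1}^P a(v_i, v_i). -/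
/-- The Cauchy–Schwarz bound `B(∑ v_i, ∑ v_i) ≤ #s · ∑ B(v_i, v_i)` for a symmetric positive
semidefinite bilinear form. -/
theorem LinearMap.BilinForm.apply_sum_sum_le_card_mul_sum
    {V ι : Type*} [AddCommGroup V] [Module ℝ V] (B : LinearMap.BilinForm ℝ V)
    (hsymm : ∀ u v, B u v = B v u) (hpsd : ∀ v, 0 ≤ B v v) (s : Finset ι) (v : ι → V) :
    B (∑ i ∈ s, v i) (∑ i ∈ s, v i) ≤ (s.card : ℝ) * ∑ i ∈ s, B (v i) (v i) := by
  have hpair : ∀ i j, B (v i) (v j) ≤ (B (v i) (v i) + B (v j) (v j)) / 2 := fun i j ↦ by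
    have h := hpsd (v i - v j)
    simp only [map_sub, LinearMap.sub_apply] at h
    linarith [hsymm (v i) (v j)]
  calc B (∑ i ∈ s, v i) (∑ i ∈ s, v i) = ∑ i ∈ s, ∑ j ∈ s, B (v i) (v j) := by
        simp only [map_sum, LinearMap.sum_apply]
        exact Finset.sum_comm
    _ ≤ ∑ i ∈ s, ∑ j ∈ s, (B (v i) (v i) + B (v j) (v j)) / 2 :=
        Finset.sum_le_sum fun i _ ↦ Finset.sum_le_sum fun j _ ↦ hpair i j
    _ = (s.card : ℝ) * ∑ i ∈ s, B (v i) (v i) := by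
        simp only [← Finset.sum_div, Finset.sum_add_distrib, Finset.sum_const, nsmul_eq_mul,
          ← Finset.mul_sum]
        ring

/-- strengthened triangle inequality under the square with constant
`k₀` for a sum `a = ∑_τ a_τ` of symmetric PSD local bilinear forms: if each index `τ`
lies in at most `k₀` of the subsets `T_i` and `v_i` is supported (w.r.t. `a_τ`) only on
`T_i`, then `a(∑ v_i, ∑ v_i) ≤ k₀ ∑ a(v_i, v_i)`. -/
theorem strengthened_triangle_inequality_under_square
    {V : Type*} [AddCommGroup V] [Module ℝ V]
    {ι : Type*} [Fintype ι] [DecidableEq ι] (aT : ι → LinearMap.BilinForm ℝ V)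
    (haT_symm : ∀ τ u v, aT τ u v = aT τ v u) (haT_psd : ∀ τ v, 0 ≤ aT τ v v)
    (P : ℕ) (v : Fin P → V) (T : Fin P → Finset ι)
    (k0 : ℕ)
    (hcard : ∀ τ : ι, (Finset.univ.filter (fun i : Fin P => τ ∈ T i)).card ≤ k0)
    (hsupp : ∀ (i : Fin P) (τ : ι), τ ∉ T i → ∀ w : V, aT τ (v i) w = 0) :
    (∑ τ : ι, aT τ (∑ i : Fin P, v i) (∑ i : Fin P, v i)) ≤
      (k0 : ℝ) * ∑ i : Fin P, ∑ τ : ι, aT τ (v i) (v i) := by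
  rw [Finset.sum_comm, Finset.mul_sum]
  refine Finset.sum_le_sum fun τ _ ↦ ?_
  set s := Finset.univ.filter (fun i : Fin P => τ ∈ T i)
  have hzero : ∀ i, i ∉ s → ∀ w, aT τ (v i) w = 0 := fun i hi ↦
    hsupp i τ (by simpa [s] using hi)
  have hrestrict : ∀ w, aT τ (∑ i, v i) w = aT τ (∑ i ∈ s, v i) w := fun w ↦ by
    simp only [map_sum, LinearMap.sum_apply]
    exact (Finset.sum_subset s.subset_univ fun i _ hi ↦ hzero i hi w).symm
  calc aT τ (∑ i, v i) (∑ i, v i) = aT τ (∑ i ∈ s, v i) (∑ i ∈ s, v i) := by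
        rw [hrestrict, haT_symm, hrestrict]
    _ ≤ (s.card : ℝ) * ∑ i ∈ s, aT τ (v i) (v i) :=
        (aT τ).apply_sum_sum_le_card_mul_sum (haT_symm τ) (haT_psd τ) s v
    _ ≤ (k0 : ℝ) * ∑ i ∈ s, aT τ (v i) (v i) :=
        mul_le_mul_of_nonneg_right (Nat.cast_le.mpr (hcard τ))
          (Finset.sum_nonneg fun i _ ↦ haT_psd τ (v i))
    _ = (k0 : ℝ) * ∑ i, aT τ (v i) (v i) := by
        rw [Finset.sum_subset s.subset_univ fun i _ hi ↦ hzero i hi (v i)]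
end

section
/- Let V be a real vector space, let N and Q be symmetric positive semidefinite bilinear forms on V, let A be a symmetric bilinear form on V, and let σ > θ > 0 and s > 0 be real numbers such that for all v ∈ V: A(v,v) ≤ (σ + θ) N(v,v) + s^{-1} Q(v,v) and (σ − θ) N(v,v) ≤ A(v,v) + s^{-1} Q(v,v). Then for any k ≥ 1 vectors v_1, …, v_k ∈ V: A(Σ_{i=1}^k v_i, Σ_{i=1}^k v_i) ≤ k (σ + θ)/(σ − θ) Σ_{i=1}^k A(v_i, v_i) + (k/s) · (2σ)/(σ − θ) · Σ_{i=1}^k Q(v_i, v_i). -/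
/-- For a positive semidefinite bilinear form, the value at a sum of vectors is at most the number
of vectors times the sum of the values. -/
theorem LinearMap.BilinForm.apply_sum_self_le_card_mul {V ι : Type*} [AddCommGroup V] [Module ℝ V]
    (B : LinearMap.BilinForm ℝ V) (hB : ∀ v, 0 ≤ B v v) (t : Finset ι) (w : ι → V) :
    B (∑ i ∈ t, w i) (∑ i ∈ t, w i) ≤ (t.card : ℝ) * ∑ i ∈ t, B (w i) (w i) := by
  have hexp : ∑ i ∈ t, ∑ j ∈ t, B (w i - w j) (w i - w j) =
      2 * ((t.card : ℝ) * ∑ i ∈ t, B (w i) (w i)) - 2 * B (∑ i ∈ t, w i) (∑ i ∈ t, w i) := by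
    have hcomm : ∑ i ∈ t, ∑ j ∈ t, B (w j) (w i) = ∑ i ∈ t, ∑ j ∈ t, B (w i) (w j) :=
      Finset.sum_comm
    simp only [map_sub, LinearMap.sub_apply, Finset.sum_sub_distrib, map_sum,
      LinearMap.sum_apply, Finset.sum_const, nsmul_eq_mul, ← Finset.mul_sum]
    linarith
  have hnonneg : 0 ≤ ∑ i ∈ t, ∑ j ∈ t, B (w i - w j) (w i - w j) :=
    Finset.sum_nonneg fun i _ => Finset.sum_nonneg fun j _ => hB _
  linarith


/-- Lemma 3.9, abstract form: bound for a DG face bilinear form `A` on a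
sum of `k` functions. `N` is the squared jump seminorm on the face, `Q` the energy of
the adjacent elements; the hypotheses encode the consistency-term bound with penalty
parameter `σ > θ > 0` and free parameter `s > 0`. -/
theorem dg_face_form_sum_bound
    {V : Type*} [AddCommGroup V] [Module ℝ V]
    (N Q A : LinearMap.BilinForm ℝ V)
    (hN_symm : ∀ u v, N u v = N v u) (hN_psd : ∀ v, 0 ≤ N v v)
    (hQ_symm : ∀ u v, Q u v = Q v u) (hQ_psd : ∀ v, 0 ≤ Q v v)
    (hA_symm : ∀ u v, A u v = A v u)
    (sigma theta s : ℝ) (htheta : 0 < theta) (hsigma : theta < sigma) (hs : 0 < s)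
    (hupper : ∀ v, A v v ≤ (sigma + theta) * N v v + s⁻¹ * Q v v)
    (hlower : ∀ v, (sigma - theta) * N v v ≤ A v v + s⁻¹ * Q v v)
    (k : ℕ) (hk : 1 ≤ k) (w : Fin k → V) :
    A (∑ i : Fin k, w i) (∑ i : Fin k, w i) ≤
      (k : ℝ) * ((sigma + theta) / (sigma - theta)) * (∑ i : Fin k, A (w i) (w i)) +
        ((k : ℝ) / s) * (2 * sigma / (sigma - theta)) * (∑ i : Fin k, Q (w i) (w i)) := by
  have hN := N.apply_sum_self_le_card_mul hN_psd Finset.univ w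
  have hQ := Q.apply_sum_self_le_card_mul hQ_psd Finset.univ w
  rw [Finset.card_fin] at hN hQ
  have hd : 0 < sigma - theta := sub_pos.2 hsigma
  have hlow : ∑ i, N (w i) (w i) ≤
      (∑ i, A (w i) (w i) + s⁻¹ * ∑ i, Q (w i) (w i)) / (sigma - theta) := by
    rw [le_div_iff₀' hd, Finset.mul_sum, Finset.mul_sum, ← Finset.sum_add_distrib]
    exact Finset.sum_le_sum fun i _ => hlower (w i)
  have hp : 0 ≤ sigma + theta := by linarith
  calc A (∑ i, w i) (∑ i, w i)
      ≤ (sigma + theta) * N (∑ i, w i) (∑ i, w i) + s⁻¹ * Q (∑ i, w i) (∑ i, w i) := hupper _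
    _ ≤ (sigma + theta) * (k * ∑ i, N (w i) (w i)) + s⁻¹ * (k * ∑ i, Q (w i) (w i)) := by
      gcongr
    _ ≤ (sigma + theta) *
          (k * ((∑ i, A (w i) (w i) + s⁻¹ * ∑ i, Q (w i) (w i)) / (sigma - theta))) +
          s⁻¹ * (k * ∑ i, Q (w i) (w i)) := by
      gcongr
    _ = _ := by
      field_simp
      ring
end
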